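/- Let 1 ≤ p < q ≤ ∞, set α = 1/p − 1/q (with the convention 1/∞ = 0), and let m, n ∈ ℕ with m ≥ 2n and m ≤ 2ⁿ. For each i ∈ {1, …, m} let X_i, Y_i be Banach spaces and T_i a bounded linear operator from X_i to Y_i, and let T : ℓ_p^m({X_i}) → ℓ_q^m({Y_i}) be the diagonal operator T(x₁, …, x_m) = (T₁(x₁), …, T_m(x_m)). Suppose ‖T₁‖ ≥ ‖T₂‖ ≥ … ≥ ‖T_m‖ and ‖T₁‖ ≤ 2‖T_n‖. Put A(n,m) = max over s ∈ {n, n+1, …, m} with s ≤ 2ⁿ of ‖T_s‖·(log₂(2s/n)/n)^α, and B(n,m) = max over k ∈ {1,…,n}, i ∈ {1,…,m} of (k/n)^α·e_k(T_i). Then c₁·A(n,m) ≤ e_n(T) ≤ c₂·max(A(n,m), B(n,m)), where c₁, c₂ are positive constants depending only on p and q. -/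

import Mathlib

open Metric Set
open scoped ENNReal

/-- The `n`-th (dyadic) entropy number of a bounded linear operator `T : X → Y`:
the infimum of all `ε > 0` such that the image of the closed unit ball of `X`
can be covered by `2 ^ (n - 1)` closed balls of radius `ε` in `Y`. -/
noncomputable def entropyNum {X Y : Type*} [NormedAddCommGroup X] [NormedSpace ℝ X]
    [NormedAddCommGroup Y] [NormedSpace ℝ Y] (n : ℕ) (T : X →L[ℝ] Y) : ℝ :=
  sInf {ε : ℝ | 0 < ε ∧ ∃ S : Finset Y, S.card ≤ 2 ^ (n - 1) ∧
    T '' closedBall 0 1 ⊆ ⋃ y ∈ S, closedBall y ε}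

/-- The `n`-th (dyadic) inner entropy number of a bounded linear operator `T : X → Y`:
the supremum of all `ε > 0` such that there are `2 ^ (n - 1) + 1` points in the closed
unit ball of `X` whose images under `T` are pairwise at distance at least `2 * ε`. -/
noncomputable def innerEntropyNum {X Y : Type*} [NormedAddCommGroup X] [NormedSpace ℝ X]
    [NormedAddCommGroup Y] [NormedSpace ℝ Y] (n : ℕ) (T : X →L[ℝ] Y) : ℝ :=
  sSup {ε : ℝ | 0 < ε ∧ ∃ x : Fin (2 ^ (n - 1) + 1) → X, (∀ i, ‖x i‖ ≤ 1) ∧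
    ∀ i j, i ≠ j → 2 * ε ≤ ‖T (x i) - T (x j)‖}

/-- The Gilbert–Varshamov bound for words of length `k` at relative distance one half. -/
lemma exists_code_card {α : Type*} [Fintype α] [DecidableEq α] (k : ℕ) (hk : 1 ≤ k) :
    ∃ W : Finset (Fin k → α),
      (∀ v ∈ W, ∀ w ∈ W, v ≠ w → k ≤ 2 * hammingDist v w) ∧
      Fintype.card α ^ k ≤ W.card * (2 ^ k * Fintype.card α ^ (k / 2)) := by
  classical
  obtain ⟨W, hW, hmax⟩ := Finset.exists_max_image
    (Finset.univ.filter fun W : Finset (Fin k → α) =>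
      ∀ v ∈ W, ∀ w ∈ W, v ≠ w → k ≤ 2 * hammingDist v w) Finset.card
    ⟨∅, by simp⟩
  simp only [Finset.mem_filter, Finset.mem_univ, true_and] at hW hmax
  refine ⟨W, hW, ?_⟩
  have hcov : ∀ v : Fin k → α, ∃ w ∈ W, 2 * hammingDist v w < k := by
    intro v
    by_contra! hv
    have hvW : v ∉ W := fun h => by
      have := hv v h
      simp at this
      omega
    have := hmax (insert v W) (by
      intro a ha b hb hab
      rcases Finset.mem_insert.1 ha with rfl | ha' <;> rcases Finset.mem_insert.1 hb with rfl | hb'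
      · exact absurd rfl hab
      · exact hv b hb'
      · rw [hammingDist_comm]; exact hv a ha'
      · exact hW a ha' b hb' hab)
    rw [Finset.card_insert_of_notMem hvW] at this
    omega
  by_cases hα : IsEmpty α
  · have : Fintype.card α = 0 := Fintype.card_eq_zero
    rw [this, zero_pow (by omega)]
    exact Nat.zero_le _
  have hα1 : 1 ≤ Fintype.card α := by
    rw [not_isEmpty_iff] at hα
    exact Fintype.card_pos
  let box (w : Fin k → α) (D : Finset (Fin k)) : Finset (Fin k → α) :=
    Fintype.piFinset fun j => if j ∈ D then Finset.univ else {w j}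
  have hbox : ∀ w D, (box w D).card = Fintype.card α ^ D.card := by
    intro w D
    simp only [box, Fintype.card_piFinset]
    rw [← Finset.prod_subset (Finset.subset_univ D)]
    · rw [Finset.prod_congr rfl (g := fun _ => Fintype.card α)]
      · simp
      · intro j hj; simp [hj]
    · intro j _ hj; simp [hj]
  have hsub : (Finset.univ : Finset (Fin k → α)) ⊆ W.biUnion fun w =>
      (Finset.univ.filter fun D : Finset (Fin k) => D.card ≤ k / 2).biUnion (box w) := by
    intro v _
    obtain ⟨w, hw, hd⟩ := hcov v
    simp only [Finset.mem_biUnion, Finset.mem_filter, Finset.mem_univ, true_and]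
    refine ⟨w, hw, Finset.univ.filter fun j => v j ≠ w j, ?_, ?_⟩
    · change hammingDist v w ≤ _
      omega
    · simp only [box, Fintype.mem_piFinset]
      intro j
      by_cases h : v j = w j <;> simp [h]
  calc Fintype.card α ^ k = (Finset.univ : Finset (Fin k → α)).card := by simp
    _ ≤ _ := Finset.card_le_card hsub
    _ ≤ W.card * (2 ^ k * Fintype.card α ^ (k / 2)) := by
      apply Finset.card_biUnion_le_card_mul
      intro w _
      refine (Finset.card_biUnion_le_card_mul _ _ (Fintype.card α ^ (k / 2)) ?_).trans ?_
      · intro D hD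
        rw [hbox]
        exact Nat.pow_le_pow_right hα1 (Finset.mem_filter.1 hD).2
      · gcongr
        refine (Finset.card_filter_le _ _).trans ?_
        simp

/-- A code over an alphabet with `64 * b` letters that has more than `2 ^ (n - 1)` words. -/
lemma exists_large_code (k b n : ℕ) (hk : 1 ≤ k) (hn : 1 ≤ n) (hb : 4 ^ n ≤ (16 * b) ^ k) :
    ∃ W : Finset (Fin k → Fin b × Fin 64),
      (∀ v ∈ W, ∀ w ∈ W, v ≠ w → k ≤ 2 * hammingDist v w) ∧ 2 ^ (n - 1) < W.card := by
  obtain ⟨W, hW, hc⟩ := exists_code_card (α := Fin b × Fin 64) k hk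
  refine ⟨W, hW, ?_⟩
  simp only [Fintype.card_prod, Fintype.card_fin] at hc
  have hb0 : 0 < b := by
    rcases Nat.eq_zero_or_pos b with rfl | h
    · simp [zero_pow (show k ≠ 0 by omega)] at hb
    · exact h
  set N := b * 64 with hN
  have hN0 : 0 < N := by omega
  have h1 : N ^ (k / 2) * N ^ (k / 2) ≤ N ^ k := by
    rw [← pow_add]; exact Nat.pow_le_pow_right hN0 (by omega)
  have h2 : N ^ k * N ^ k ≤ (W.card ^ 2 * 4 ^ k) * N ^ k := by
    calc N ^ k * N ^ k ≤ (W.card * (2 ^ k * N ^ (k / 2))) * (W.card * (2 ^ k * N ^ (k / 2))) :=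
          Nat.mul_le_mul hc hc
      _ = W.card ^ 2 * (2 ^ k * 2 ^ k) * (N ^ (k / 2) * N ^ (k / 2)) := by ring
      _ = W.card ^ 2 * 4 ^ k * (N ^ (k / 2) * N ^ (k / 2)) := by rw [← mul_pow]; norm_num
      _ ≤ _ := by gcongr
  have h3 : N ^ k ≤ W.card ^ 2 * 4 ^ k := Nat.le_of_mul_le_mul_right h2 (by positivity)
  have h4 : N ^ k = (16 * b) ^ k * 4 ^ k := by rw [← mul_pow]; congr 1; omega
  rw [h4] at h3
  have h5 : (16 * b) ^ k ≤ W.card ^ 2 := Nat.le_of_mul_le_mul_right h3 (by positivity)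
  have h6 : (2 ^ n) ^ 2 ≤ W.card ^ 2 := by
    calc (2 ^ n) ^ 2 = 4 ^ n := by rw [← pow_mul, mul_comm, pow_mul]; norm_num
      _ ≤ _ := hb.trans h5
  have h7 : 2 ^ n ≤ W.card := by
    by_contra! h
    exact absurd h6 (not_le.2 (Nat.pow_lt_pow_left h two_ne_zero))
  exact (Nat.pow_lt_pow_right one_lt_two (by omega)).trans_le h7

/-- The block length and block count used in the packing argument. -/
lemma exists_block_parameters (n s : ℕ) (hn : 1 ≤ n) (hns : n ≤ s) (hs : s ≤ 2 ^ n) :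
    ∃ k b : ℕ, 1 ≤ k ∧ k * b ≤ s ∧ k * Real.logb 2 (2 * s / n) ≤ 4 * n ∧
      4 ^ n ≤ (16 * b) ^ k := by
  set l := Real.logb 2 (2 * s / n) with hl
  have hn0 : (0 : ℝ) < n := by exact_mod_cast hn
  have hs0 : (0 : ℝ) < s := by exact_mod_cast (hn.trans hns)
  have hn1 : (1 : ℝ) ≤ n := by exact_mod_cast hn
  have hnsR : (n : ℝ) ≤ s := by exact_mod_cast hns
  have hpos : (0 : ℝ) < 2 * s / n := by positivity
  have hl1 : 1 ≤ l := by
    rw [hl, Real.le_logb_iff_rpow_le one_lt_two hpos, Real.rpow_one, le_div_iff₀ hn0]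
    linarith
  have hl2 : l ≤ 2 * n := by
    rw [hl, Real.logb_le_iff_le_rpow one_lt_two hpos]
    have h1 : (s : ℝ) ≤ 2 ^ n := by exact_mod_cast hs
    calc 2 * s / n ≤ 2 * (s : ℝ) := div_le_self (by positivity) hn1
      _ ≤ 2 ^ (n + 1) := by rw [pow_succ]; linarith
      _ ≤ 2 ^ (2 * n) := pow_le_pow_right₀ one_le_two (by omega)
      _ = (2 : ℝ) ^ (2 * n : ℝ) := by rw [← Real.rpow_natCast]; norm_num
  set k := ⌈2 * (n : ℝ) / (2 + l)⌉₊ with hk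
  have hk1 : 1 ≤ k := Nat.ceil_pos.2 (by positivity)
  have hkn : k ≤ n := by
    apply Nat.ceil_le.2
    rw [div_le_iff₀ (by positivity)]
    nlinarith
  have hkl : 2 * (n : ℝ) ≤ k * (2 + l) := by
    rw [← div_le_iff₀ (by positivity)]
    exact Nat.le_ceil _
  have hku : (k : ℝ) < 2 * n / (2 + l) + 1 := Nat.ceil_lt_add_one (by positivity)
  refine ⟨k, s / k, hk1, Nat.mul_div_le s k, ?_, ?_⟩
  · have : 2 * n / (2 + l) * l ≤ 2 * n := by
      rw [div_mul_eq_mul_div, div_le_iff₀ (by positivity)]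
      nlinarith
    nlinarith
  · have hb : s ≤ 2 * n * (s / k) := by
      have h1 : 1 ≤ s / k := (Nat.one_le_div_iff (by omega)).2 (hkn.trans hns)
      have h2 := Nat.lt_mul_div_succ s (show 0 < k by omega)
      nlinarith
    have hbR : (s : ℝ) ≤ 2 * n * (s / k : ℕ) := by exact_mod_cast hb
    have h16 : (2 : ℝ) ^ (2 + l) ≤ 16 * (s / k : ℕ) := by
      rw [Real.rpow_add two_pos, hl, Real.rpow_logb two_pos (by norm_num) hpos]
      rw [mul_div_assoc', div_le_iff₀ hn0]
      norm_num
      linarith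
    have : (4 : ℝ) ^ n ≤ (16 * (s / k : ℕ)) ^ k := by
      calc (4 : ℝ) ^ n = 2 ^ (2 * n : ℝ) := by
            rw [Real.rpow_mul two_pos.le, Real.rpow_natCast]; norm_num
        _ ≤ 2 ^ ((2 + l) * k) := Real.rpow_le_rpow_of_exponent_le one_le_two (by linarith)
        _ = (2 ^ (2 + l)) ^ k := by rw [Real.rpow_mul two_pos.le, Real.rpow_natCast]
        _ ≤ _ := by gcongr
    exact_mod_cast this

lemma PiLp.mul_card_rpow_le_norm {ι : Type*} [Fintype ι] {Y : ι → Type*}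
    [∀ i, NormedAddCommGroup (Y i)] (q : ℝ≥0∞) [Fact (1 ≤ q)] (z : PiLp q Y)
    (D : Finset ι) (hD : D.Nonempty) (c : ℝ) (hc : 0 ≤ c) (h : ∀ i ∈ D, c ≤ ‖z i‖) :
    c * (D.card : ℝ) ^ (1 / q.toReal) ≤ ‖z‖ := by
  rcases eq_or_ne q ∞ with rfl | hq
  · obtain ⟨i, hi⟩ := hD
    simpa using (h i hi).trans (PiLp.norm_apply_le z i)
  · have hq0 : 0 < q.toReal :=
      ENNReal.toReal_pos (zero_lt_one.trans_le Fact.out).ne' hq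
    rw [PiLp.norm_eq_sum hq0]
    have h1 : c ^ q.toReal * D.card ≤ ∑ i, ‖z i‖ ^ q.toReal := by
      calc c ^ q.toReal * D.card = ∑ i ∈ D, c ^ q.toReal := by simp [mul_comm]
        _ ≤ ∑ i ∈ D, ‖z i‖ ^ q.toReal :=
          Finset.sum_le_sum fun i hi => Real.rpow_le_rpow hc (h i hi) hq0.le
        _ ≤ _ := Finset.sum_le_sum_of_subset_of_nonneg (Finset.subset_univ _)
          fun i _ _ => by positivity
    calc c * (D.card : ℝ) ^ (1 / q.toReal) = (c ^ q.toReal * D.card) ^ (1 / q.toReal) := by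
          rw [Real.mul_rpow (by positivity) (by positivity), ← Real.rpow_mul hc,
            mul_one_div_cancel hq0.ne', Real.rpow_one]
      _ ≤ _ := Real.rpow_le_rpow (by positivity) h1 (by positivity)

lemma PiLp.norm_le_of_forall_le_rpow {ι : Type*} [Fintype ι] {Y : ι → Type*}
    [∀ i, NormedAddCommGroup (Y i)] (q : ℝ≥0∞) [Fact (1 ≤ q)] (z : PiLp q Y)
    (b : ι → ℝ) (hb : ∀ i, 0 ≤ b i) (hsum : ∑ i, b i ≤ 1) (C : ℝ) (hC : 0 ≤ C)
    (h : ∀ i, ‖z i‖ ≤ C * b i ^ (1 / q.toReal)) : ‖z‖ ≤ C := by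
  rcases eq_or_ne q ∞ with rfl | hq
  · rw [PiLp.norm_eq_ciSup]
    exact Real.iSup_le (fun i => by simpa using h i) hC
  · have hq0 : 0 < q.toReal :=
      ENNReal.toReal_pos (zero_lt_one.trans_le Fact.out).ne' hq
    rw [PiLp.norm_eq_sum hq0]
    have h1 : ∑ i, ‖z i‖ ^ q.toReal ≤ C ^ q.toReal := by
      calc ∑ i, ‖z i‖ ^ q.toReal ≤ ∑ i, C ^ q.toReal * b i := by
            refine Finset.sum_le_sum fun i _ => ?_
            refine (Real.rpow_le_rpow (norm_nonneg _) (h i) hq0.le).trans_eq ?_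
            rw [Real.mul_rpow hC (Real.rpow_nonneg (hb i) _), ← Real.rpow_mul (hb i),
              one_div_mul_cancel hq0.ne', Real.rpow_one]
        _ = C ^ q.toReal * ∑ i, b i := by rw [Finset.mul_sum]
        _ ≤ C ^ q.toReal * 1 := by gcongr
        _ = _ := mul_one _
    calc _ ≤ (C ^ q.toReal) ^ (1 / q.toReal) :=
          Real.rpow_le_rpow (by positivity) h1 (by positivity)
      _ = C := by rw [← Real.rpow_mul hC, mul_one_div_cancel hq0.ne', Real.rpow_one]

lemma PiLp.sum_rpow_le_one_iff {ι : Type*} [Fintype ι] {X : ι → Type*}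
    [∀ i, NormedAddCommGroup (X i)] (p : ℝ≥0∞) (hp : 0 < p.toReal)
    [Fact (1 ≤ p)] (x : PiLp p X) :
    ‖x‖ ≤ 1 ↔ ∑ i, ‖x i‖ ^ p.toReal ≤ 1 := by
  rw [PiLp.norm_eq_sum hp]
  have h : 0 ≤ ∑ i, ‖x i‖ ^ p.toReal := by positivity
  refine ⟨fun h1 => ?_, fun h1 => Real.rpow_le_one h h1 (by positivity)⟩
  by_contra! h2
  exact absurd h1 (not_le.2 (Real.one_lt_rpow h2 (by positivity)))

section EntropyNum

variable {X Y : Type*} [NormedAddCommGroup X] [NormedSpace ℝ X]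
  [NormedAddCommGroup Y] [NormedSpace ℝ Y]

lemma entropyNum_set_nonempty (n : ℕ) (T : X →L[ℝ] Y) :
    {ε : ℝ | 0 < ε ∧ ∃ S : Finset Y, S.card ≤ 2 ^ (n - 1) ∧
      T '' closedBall 0 1 ⊆ ⋃ y ∈ S, closedBall y ε}.Nonempty := by
  refine ⟨‖T‖ + 1, by positivity, {0}, by simpa using Nat.one_le_two_pow, ?_⟩
  rintro _ ⟨x, hx, rfl⟩
  simp only [mem_closedBall, dist_zero_right] at hx
  simp only [Finset.mem_singleton, iUnion_iUnion_eq_left, mem_closedBall, dist_zero_right]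
  have := T.le_opNorm x
  nlinarith [norm_nonneg T]

lemma entropyNum_le (n : ℕ) (T : X →L[ℝ] Y) (ε : ℝ) (hε : 0 < ε) (S : Finset Y)
    (hS : S.card ≤ 2 ^ (n - 1)) (h : ∀ x, ‖x‖ ≤ 1 → ∃ y ∈ S, ‖T x - y‖ ≤ ε) :
    entropyNum n T ≤ ε := by
  refine csInf_le ⟨0, fun a ha => ha.1.le⟩ ⟨hε, S, hS, ?_⟩
  rintro _ ⟨x, hx, rfl⟩
  obtain ⟨y, hy, hxy⟩ := h x (by simpa using hx)
  simp only [mem_iUnion]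
  exact ⟨y, hy, by rwa [mem_closedBall, dist_eq_norm]⟩

lemma exists_cover_of_entropyNum_lt (n : ℕ) (T : X →L[ℝ] Y) (ε : ℝ) (h : entropyNum n T < ε) :
    ∃ S : Finset Y, S.card ≤ 2 ^ (n - 1) ∧ ∀ x, ‖x‖ ≤ 1 → ∃ y ∈ S, ‖T x - y‖ ≤ ε := by
  obtain ⟨a, ⟨-, S, hS, hcov⟩, haε⟩ := exists_lt_of_csInf_lt (entropyNum_set_nonempty n T) h
  refine ⟨S, hS, fun x hx => ?_⟩
  have := hcov ⟨x, by simpa using hx, rfl⟩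
  simp only [mem_iUnion, mem_closedBall, dist_eq_norm] at this
  obtain ⟨y, hy, hxy⟩ := this
  exact ⟨y, hy, hxy.trans haε.le⟩

/-- A large separated family in the image of the unit ball bounds the entropy number below. -/
lemma half_le_entropyNum_of_separated {ι : Type*} (n : ℕ) (T : X →L[ℝ] Y) (W : Finset ι)
    (hW : 2 ^ (n - 1) < W.card) (f : ι → X) (hf : ∀ w ∈ W, ‖f w‖ ≤ 1) (δ : ℝ)
    (hδ : ∀ v ∈ W, ∀ w ∈ W, v ≠ w → δ ≤ ‖T (f v) - T (f w)‖) :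
    δ / 2 ≤ entropyNum n T := by
  classical
  refine le_of_forall_gt_imp_ge_of_dense fun ε hε => ?_
  obtain ⟨S, hS, hcov⟩ := exists_cover_of_entropyNum_lt n T ε hε
  have hc : ∀ w ∈ W, ∃ y ∈ S, ‖T (f w) - y‖ ≤ ε := fun w hw => hcov _ (hf w hw)
  choose! g hgS hg using hc
  obtain ⟨v, hv, w, hw, hvw, hgvw⟩ :=
    Finset.exists_ne_map_eq_of_card_lt_of_maps_to (hS.trans_lt hW) hgS
  have h1 := hδ v hv w hw hvw
  have h2 := norm_sub_le_norm_sub_add_norm_sub (T (f v)) (g v) (T (f w))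
  rw [norm_sub_rev (g v), hgvw] at h2
  have h3 := hg v hv
  have h4 := hg w hw
  rw [hgvw] at h3
  linarith

lemma exists_half_opNorm_le (T : X →L[ℝ] Y) : ∃ x : X, ‖x‖ ≤ 1 ∧ ‖T‖ / 2 ≤ ‖T x‖ := by
  rcases (norm_nonneg T).eq_or_lt with h | h
  · exact ⟨0, by simp, by simp [← h]⟩
  · obtain ⟨x, hx, hT⟩ := T.exists_lt_apply_of_lt_opNorm (show ‖T‖ / 2 < ‖T‖ by linarith)
    exact ⟨x, hx.le, hT.le⟩

end EntropyNum

/-- The packing bound: `k` blocks of `b` coordinates on which the operators have norm at least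
`lam` carry a code with at least `2 ^ (n - 1) + 1` words. -/
lemma packing_le_entropyNum {p q : ℝ≥0∞} [Fact (1 ≤ p)] [Fact (1 ≤ q)] (hp : 0 < p.toReal)
    {ι : Type*} [Fintype ι] {X Y : ι → Type*}
    [∀ i, NormedAddCommGroup (X i)] [∀ i, NormedSpace ℝ (X i)]
    [∀ i, NormedAddCommGroup (Y i)] [∀ i, NormedSpace ℝ (Y i)]
    (Ti : ∀ i, X i →L[ℝ] Y i) (T : PiLp p X →L[ℝ] PiLp q Y) (hT : ∀ x i, T x i = Ti i (x i))
    (n k b : ℕ) (hn : 1 ≤ n) (hk : 1 ≤ k) (hkb : 4 ^ n ≤ (16 * b) ^ k)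
    (φ : Fin k × Fin b → ι) (hφ : Function.Injective φ) (lam : ℝ) (hlam0 : 0 ≤ lam)
    (hlam : ∀ a, lam ≤ ‖Ti (φ a)‖) :
    lam / 512 * (k : ℝ) ^ (-(1 / p.toReal - 1 / q.toReal)) ≤ entropyNum n T := by
  classical
  obtain ⟨W, hW, hcard⟩ := exists_large_code k b n hk hn hkb
  choose u hu1 hu2 using fun i => exists_half_opNorm_le (Ti i)
  have hk0 : (0 : ℝ) < k := by exact_mod_cast hk
  have hk1 : (1 : ℝ) ≤ k := by exact_mod_cast hk
  let lev (a : Fin b × Fin 64) : ℝ := ((a.2 : ℕ) + 1) / 64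
  have hlev0 : ∀ a, 1 / 64 ≤ lev a := fun a => by
    simp only [lev]
    gcongr
    simp
  have hlev1 : ∀ a, lev a ≤ 1 := fun a => by
    have : ((a.2 : ℕ) : ℝ) + 1 ≤ 64 := by exact_mod_cast a.2.isLt
    simp only [lev]
    rw [div_le_one (by norm_num)]
    exact this
  let c (w : Fin k → Fin b × Fin 64) : ι → ℝ :=
    Function.extend φ (fun a => if (w a.1).1 = a.2 then lev (w a.1) else 0) 0
  have hcφ : ∀ w a, c w (φ a) = if (w a.1).1 = a.2 then lev (w a.1) else 0 :=
    fun w a => hφ.extend_apply _ _ _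
  have hc1 : ∀ w i, |c w i| ≤ 1 := by
    intro w i
    by_cases h : ∃ a, φ a = i
    · obtain ⟨a, rfl⟩ := h
      rw [hcφ]
      split_ifs
      · rw [abs_of_nonneg (by linarith [hlev0 (w a.1)])]
        exact hlev1 _
      · simp
    · simp [c, Function.extend_apply' _ _ _ h]
  have hcsupp : ∀ w i, i ∉ Finset.univ.image (fun j => φ (j, (w j).1)) → c w i = 0 := by
    intro w i hi
    by_cases h : ∃ a, φ a = i
    · obtain ⟨a, rfl⟩ := h
      rw [hcφ, if_neg]
      rintro h
      apply hi
      simp only [Finset.mem_image, Finset.mem_univ, true_and]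
      exact ⟨a.1, by rw [h]⟩
    · simp [c, Function.extend_apply' _ _ _ h]
  set κ : ℝ := (k : ℝ) ^ (-(1 / p.toReal)) with hκ
  have hκ0 : 0 < κ := by positivity
  let f (w : Fin k → Fin b × Fin 64) : PiLp p X := WithLp.toLp p fun i => (κ * c w i) • u i
  have hf : ∀ w i, f w i = (κ * c w i) • u i := fun w i => rfl
  have hfnorm : ∀ w, ‖f w‖ ≤ 1 := by
    intro w
    rw [PiLp.sum_rpow_le_one_iff p hp]
    have hterm : ∀ i, ‖f w i‖ ^ p.toReal ≤ (k : ℝ)⁻¹ := by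
      intro i
      have h1 : ‖f w i‖ ≤ κ := by
        rw [hf, norm_smul, Real.norm_eq_abs, abs_mul, abs_of_pos hκ0]
        calc κ * |c w i| * ‖u i‖ ≤ κ * 1 * 1 := by
              gcongr
              exacts [hc1 w i, hu1 i]
          _ = κ := by ring
      refine (Real.rpow_le_rpow (norm_nonneg _) h1 hp.le).trans_eq ?_
      rw [hκ, ← Real.rpow_mul hk0.le, neg_mul, one_div_mul_cancel hp.ne', Real.rpow_neg_one]
    calc ∑ i, ‖f w i‖ ^ p.toReal
        = ∑ i ∈ Finset.univ.image (fun j => φ (j, (w j).1)), ‖f w i‖ ^ p.toReal := by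
          symm
          apply Finset.sum_subset (Finset.subset_univ _)
          intro i _ hi
          rw [hf, hcsupp w i hi]
          simp [Real.zero_rpow hp.ne']
      _ ≤ (Finset.univ.image (fun j => φ (j, (w j).1))).card • (k : ℝ)⁻¹ :=
          Finset.sum_le_card_nsmul _ _ _ fun i _ => hterm i
      _ ≤ k • (k : ℝ)⁻¹ := by
          gcongr
          exact Finset.card_image_le.trans (by simp)
      _ = 1 := by rw [nsmul_eq_mul, mul_inv_cancel₀ hk0.ne']
  have hgap : ∀ v w : Fin k → Fin b × Fin 64, ∀ j, v j ≠ w j →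
      1 / 64 ≤ |c v (φ (j, (v j).1)) - c w (φ (j, (v j).1))| := by
    intro v w j hj
    rw [hcφ, hcφ, if_pos rfl]
    dsimp only
    split_ifs with h
    · have hne : (v j).2 ≠ (w j).2 := fun h2 => hj (Prod.ext h.symm h2)
      have hne' : (((v j).2 : ℕ) : ℤ) - ((w j).2 : ℕ) ≠ 0 := by
        intro h3
        apply hne
        ext
        omega
      have h4 : (1 : ℝ) ≤ |(((v j).2 : ℕ) : ℝ) - ((w j).2 : ℕ)| := by
        exact_mod_cast Int.one_le_abs hne'
      have h5 : lev (v j) - lev (w j) = ((((v j).2 : ℕ) : ℝ) - ((w j).2 : ℕ)) / 64 := by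
        simp only [lev]
        ring
      rw [h5, abs_div, abs_of_pos (show (0 : ℝ) < 64 by norm_num)]
      gcongr
    · rw [sub_zero, abs_of_nonneg (by linarith [hlev0 (v j)])]
      exact hlev0 _
  have hθ0 : 0 ≤ 1 / q.toReal := by positivity
  have hθ1 : 1 / q.toReal ≤ 1 := by
    rcases eq_or_ne q ∞ with rfl | hq
    · simp
    · have : 1 ≤ q.toReal := by
        simpa using ENNReal.toReal_mono hq (Fact.out : 1 ≤ q)
      rw [div_le_one (by linarith)]
      exact this
  have hsep : ∀ v ∈ W, ∀ w ∈ W, v ≠ w →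
      lam / 256 * (k : ℝ) ^ (-(1 / p.toReal - 1 / q.toReal)) ≤ ‖T (f v) - T (f w)‖ := by
    intro v hv w hw hvw
    let D := (Finset.univ.filter fun j => v j ≠ w j).image fun j => φ (j, (v j).1)
    have hDcard : D.card = hammingDist v w := by
      apply Finset.card_image_of_injective
      intro j j' h
      exact congrArg Prod.fst (hφ h)
    have hdist := hW v hv w hw hvw
    have hmain := PiLp.mul_card_rpow_le_norm q (T (f v) - T (f w)) D
      (Finset.card_pos.1 (by omega)) (κ * (1 / 64) * (lam / 2)) (by positivity) (by
        intro i hi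
        obtain ⟨j, hj, rfl⟩ := Finset.mem_image.1 hi
        rw [PiLp.sub_apply, hT, hT, hf, hf, map_smul, map_smul, ← sub_smul, ← mul_sub, norm_smul,
          Real.norm_eq_abs, abs_mul, abs_of_pos hκ0]
        have h1 := hgap v w j (Finset.mem_filter.1 hj).2
        have h2 := hu2 (φ (j, (v j).1))
        have h3 := hlam (j, (v j).1)
        gcongr
        linarith)
    refine le_trans ?_ hmain
    have hd : (k : ℝ) / 2 ≤ D.card := by
      rw [hDcard, div_le_iff₀ two_pos]
      exact_mod_cast (by omega : k ≤ hammingDist v w * 2)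
    have hpow : (k : ℝ) ^ (1 / q.toReal) / 2 ≤ (D.card : ℝ) ^ (1 / q.toReal) := by
      calc (k : ℝ) ^ (1 / q.toReal) / 2 ≤ (k : ℝ) ^ (1 / q.toReal) / 2 ^ (1 / q.toReal) := by
            gcongr
            simpa using Real.rpow_le_rpow_of_exponent_le one_le_two hθ1
        _ = ((k : ℝ) / 2) ^ (1 / q.toReal) := by
            rw [Real.div_rpow hk0.le two_pos.le]
        _ ≤ _ := Real.rpow_le_rpow (by positivity) hd hθ0
    calc lam / 256 * (k : ℝ) ^ (-(1 / p.toReal - 1 / q.toReal))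
        = κ * (1 / 64) * (lam / 2) * ((k : ℝ) ^ (1 / q.toReal) / 2) := by
          rw [show -(1 / p.toReal - 1 / q.toReal) = -(1 / p.toReal) + 1 / q.toReal by ring,
            Real.rpow_add hk0, ← hκ]
          ring
      _ ≤ _ := by gcongr
  have := half_le_entropyNum_of_separated n T W hcard f (fun w _ => hfnorm w) _ hsep
  linarith

/-- Comparison of `k ^ (-α)` with `(l / n) ^ α` when `k * l ≤ 4 * n`. -/
lemma rpow_le_four_mul_rpow_neg {k l n α : ℝ} (hk : 0 < k) (hl : 0 < l) (hn : 0 < n)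
    (hα0 : 0 ≤ α) (hα1 : α ≤ 1) (h : k * l ≤ 4 * n) : (l / n) ^ α ≤ 4 * k ^ (-α) := by
  have h1 : l / n ≤ 4 * k⁻¹ := by
    rw [div_le_iff₀ hn, mul_assoc, ← div_eq_inv_mul, mul_div_assoc', le_div_iff₀ hk]
    linarith
  calc (l / n) ^ α ≤ (4 * k⁻¹) ^ α := Real.rpow_le_rpow (by positivity) h1 hα0
    _ = 4 ^ α * k ^ (-α) := by
      rw [Real.mul_rpow (by norm_num) (by positivity), Real.inv_rpow hk.le, Real.rpow_neg hk.le]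
    _ ≤ 4 * k ^ (-α) := by
      gcongr
      simpa using Real.rpow_le_rpow_of_exponent_le (show (1 : ℝ) ≤ 4 by norm_num) hα1

/-- The admissible bit allocations: every coordinate receives either no bits or at least `w i` of
them, and `32` times the total is at most `n`. -/
def bitAllocations {ι : Type*} [Fintype ι] [DecidableEq ι] (n : ℕ) (w : ι → ℕ) :
    Finset (ι → ℕ) :=
  (Fintype.piFinset fun i => insert 0 (Finset.Icc (w i) n)).filter fun k => 32 * ∑ i, k i ≤ n

lemma norm_apply_le_of_small {X Y : Type*} [NormedAddCommGroup X] [NormedSpace ℝ X]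
    [NormedAddCommGroup Y] [NormedSpace ℝ Y] (T : X →L[ℝ] Y) (x : X) {P θ M n w : ℝ}
    (hP : 1 ≤ P) (hθ0 : 0 ≤ θ) (hθ : θ ≤ 1 / P) (hM : 0 ≤ M) (hn : 0 < n) (hw : 0 < w)
    (hT : ‖T‖ ≤ 2 * M * (n / w) ^ (1 / P - θ)) (hx : n * ‖x‖ ^ P ≤ 32 * w) :
    ‖T x‖ ≤ 64 * M * (‖x‖ ^ P) ^ θ := by
  have hP0 : 0 < P := by linarith
  set a := ‖x‖ ^ P with ha
  have ha0 : 0 ≤ a := by positivity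
  have hα0 : 0 ≤ 1 / P - θ := by linarith
  have hα1 : 1 / P - θ ≤ 1 := by
    have : 1 / P ≤ 1 := by rw [div_le_one hP0]; exact hP
    linarith
  have hxa : ‖x‖ = a ^ (1 / P - θ) * a ^ θ := by
    rw [← Real.rpow_add_of_nonneg ha0 hα0 hθ0, sub_add_cancel, ha,
      ← Real.rpow_mul (norm_nonneg _), mul_one_div_cancel hP0.ne', Real.rpow_one]
  have h32 : (n / w) ^ (1 / P - θ) * a ^ (1 / P - θ) ≤ 32 := by
    rw [← Real.mul_rpow (by positivity) ha0]
    calc (n / w * a) ^ (1 / P - θ) ≤ 32 ^ (1 / P - θ) := by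
          apply Real.rpow_le_rpow (by positivity) _ hα0
          rw [div_mul_eq_mul_div, div_le_iff₀ hw]
          exact hx
      _ ≤ 32 := by
          simpa using Real.rpow_le_rpow_of_exponent_le (show (1 : ℝ) ≤ 32 by norm_num) hα1
  calc ‖T x‖ ≤ ‖T‖ * ‖x‖ := T.le_opNorm x
    _ ≤ 2 * M * (n / w) ^ (1 / P - θ) * (a ^ (1 / P - θ) * a ^ θ) := by
        rw [← hxa]; gcongr
    _ = 2 * M * ((n / w) ^ (1 / P - θ) * a ^ (1 / P - θ)) * a ^ θ := by ring
    _ ≤ 2 * M * 32 * a ^ θ := by gcongr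
    _ = _ := by ring

lemma radius_mul_le {a P θ M n k : ℝ} (hP : 1 ≤ P) (hθ0 : 0 ≤ θ)
    (hM : 0 ≤ M) (hn : 0 < n) (hk : 1 ≤ k) (hka : 32 * k ≤ n * a) :
    (32 * (k + 1) / n) ^ (1 / P) * (M * (n / k) ^ (1 / P - θ)) ≤ 64 * M * a ^ θ := by
  have hP0 : 0 < P := by linarith
  have hk0 : 0 < k := by linarith
  have hP1 : 1 / P ≤ 1 := by rw [div_le_one hP0]; exact hP
  have h1 : (32 * (k + 1) / n) ^ (1 / P) ≤ 64 * (k / n) ^ (1 / P) := by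
    calc (32 * (k + 1) / n) ^ (1 / P) ≤ (64 * (k / n)) ^ (1 / P) := by
          apply Real.rpow_le_rpow (by positivity) _ (by positivity)
          rw [mul_div_assoc']
          exact div_le_div_of_nonneg_right (by linarith) hn.le
      _ = 64 ^ (1 / P) * (k / n) ^ (1 / P) := Real.mul_rpow (by norm_num) (by positivity)
      _ ≤ _ := by
          gcongr
          simpa using Real.rpow_le_rpow_of_exponent_le (show (1 : ℝ) ≤ 64 by norm_num) hP1
  have h2 : (k / n) ^ (1 / P) * (n / k) ^ (1 / P - θ) = (k / n) ^ θ := by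
    rw [← inv_div k n, Real.inv_rpow (by positivity), ← Real.rpow_neg (by positivity),
      ← Real.rpow_add (by positivity)]
    congr 1
    ring
  have h3 : (k / n) ^ θ ≤ a ^ θ := by
    apply Real.rpow_le_rpow (by positivity) _ hθ0
    rw [div_le_iff₀ hn]
    linarith
  calc _ ≤ 64 * (k / n) ^ (1 / P) * (M * (n / k) ^ (1 / P - θ)) := by gcongr
    _ = 64 * M * ((k / n) ^ (1 / P) * (n / k) ^ (1 / P - θ)) := by ring
    _ ≤ _ := by rw [h2]; gcongr

/-- The covering bound obtained from distributing bits among the coordinates. -/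
lemma entropyNum_le_of_bitAllocations {p q : ℝ≥0∞} [Fact (1 ≤ p)] [Fact (1 ≤ q)]
    (hp : 1 ≤ p.toReal) (hpq : 1 / q.toReal ≤ 1 / p.toReal)
    {ι : Type*} [Fintype ι] [DecidableEq ι] {X Y : ι → Type*}
    [∀ i, NormedAddCommGroup (X i)] [∀ i, NormedSpace ℝ (X i)]
    [∀ i, NormedAddCommGroup (Y i)] [∀ i, NormedSpace ℝ (Y i)]
    (Ti : ∀ i, X i →L[ℝ] Y i) (T : PiLp p X →L[ℝ] PiLp q Y) (hT : ∀ x i, T x i = Ti i (x i))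
    (n : ℕ) (hn : 1 ≤ n) (w : ι → ℕ) (hw : ∀ i, 1 ≤ w i) (M : ℝ) (hM : 0 < M)
    (hnorm : ∀ i, ‖Ti i‖ ≤ 2 * M * ((n : ℝ) / w i) ^ (1 / p.toReal - 1 / q.toReal))
    (hent : ∀ i, ∀ k : ℕ, 1 ≤ k → k ≤ n →
      entropyNum k (Ti i) < M * ((n : ℝ) / k) ^ (1 / p.toReal - 1 / q.toReal))
    (hcard : ∑ k ∈ bitAllocations n w, 2 ^ ∑ i, k i ≤ 2 ^ (n - 1)) :
    entropyNum n T ≤ 64 * M := by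
  classical
  have hn0 : (0 : ℝ) < n := by exact_mod_cast hn
  have hp0 : 0 < p.toReal := by linarith
  have hθ0 : 0 ≤ 1 / q.toReal := by positivity
  have hcov : ∀ i, ∀ k : ℕ, ∃ S : Finset (Y i), 1 ≤ k → k ≤ n → S.card ≤ 2 ^ (k - 1) ∧
      ∀ x, ‖x‖ ≤ 1 → ∃ y ∈ S,
        ‖Ti i x - y‖ ≤ M * ((n : ℝ) / k) ^ (1 / p.toReal - 1 / q.toReal) := by
    intro i k
    by_cases hk : 1 ≤ k ∧ k ≤ n
    · obtain ⟨S, hS⟩ := exists_cover_of_entropyNum_lt k (Ti i) _ (hent i k hk.1 hk.2)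
      exact ⟨S, fun _ _ => hS⟩
    · exact ⟨∅, fun h1 h2 => absurd ⟨h1, h2⟩ hk⟩
  choose S hS using hcov
  let r (k : ℕ) : ℝ := (32 * ((k : ℝ) + 1) / n) ^ (1 / p.toReal)
  have hr : ∀ k, 0 < r k := fun k => by positivity
  let net (k : ι → ℕ) (i : ι) : Finset (Y i) :=
    if k i = 0 then {0} else (S i (k i)).image fun y => r (k i) • y
  refine entropyNum_le n T (64 * M) (by positivity)
    ((bitAllocations n w).biUnion fun k => (Fintype.piFinset (net k)).image (WithLp.toLp q)) ?_ ?_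
  · refine le_trans (Finset.card_biUnion_le.trans (Finset.sum_le_sum fun k hk => ?_)) hcard
    refine Finset.card_image_le.trans ?_
    rw [Fintype.card_piFinset, ← Finset.prod_pow_eq_pow_sum]
    refine Finset.prod_le_prod' fun i _ => ?_
    simp only [net]
    split_ifs with h0
    · simp [h0]
    · have hk' : k i ≤ n := by
        have h1 := Finset.single_le_sum (f := k) (fun _ _ => Nat.zero_le _) (Finset.mem_univ i)
        have h2 := (Finset.mem_filter.1 hk).2
        omega
      exact Finset.card_image_le.trans ((hS i (k i) (by omega) hk').1.trans
        (Nat.pow_le_pow_right two_pos (by omega)))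
  · intro x hx
    rw [PiLp.sum_rpow_le_one_iff p hp0] at hx
    set a : ι → ℝ := fun i => ‖x i‖ ^ p.toReal with ha
    have ha0 : ∀ i, 0 ≤ a i := fun i => by positivity
    let fl (i : ι) : ℕ := ⌊n * a i / 32⌋₊
    let k (i : ι) : ℕ := if w i ≤ fl i then fl i else 0
    have hfl : ∀ i, 32 * (fl i : ℝ) ≤ n * a i := fun i => by
      have : (fl i : ℝ) ≤ n * a i / 32 :=
        Nat.floor_le (div_nonneg (mul_nonneg hn0.le (ha0 i)) (by norm_num))
      linarith
    have hkfl : ∀ i, k i ≤ fl i := fun i => by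
      simp only [k]
      split_ifs <;> omega
    have hsumk : 32 * ∑ i, k i ≤ n := by
      have : (32 : ℝ) * ∑ i, (k i : ℝ) ≤ n := by
        calc (32 : ℝ) * ∑ i, (k i : ℝ) = ∑ i, 32 * (k i : ℝ) := Finset.mul_sum _ _ _
          _ ≤ ∑ i, n * a i := by
              refine Finset.sum_le_sum fun i _ => le_trans ?_ (hfl i)
              gcongr
              exact hkfl i
          _ = n * ∑ i, a i := (Finset.mul_sum _ _ _).symm
          _ ≤ n * 1 := by gcongr
          _ = n := mul_one _
      exact_mod_cast this
    have hkn : ∀ i, k i ≤ n := fun i => by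
      have h1 := Finset.single_le_sum (f := k) (fun _ _ => Nat.zero_le _) (Finset.mem_univ i)
      omega
    have hkmem : k ∈ bitAllocations n w := by
      refine Finset.mem_filter.2 ⟨Fintype.mem_piFinset.2 fun i => ?_, hsumk⟩
      by_cases h : w i ≤ fl i
      · refine Finset.mem_insert_of_mem (Finset.mem_Icc.2 ⟨?_, hkn i⟩)
        simp [k, h]
      · simp [k, h]
    have hy : ∀ i, ∃ y ∈ net k i, ‖Ti i (x i) - y‖ ≤ 64 * M * a i ^ (1 / q.toReal) := by
      intro i
      by_cases h : w i ≤ fl i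
      · have hki : k i = fl i := if_pos h
        have hk1 : 1 ≤ k i := hki ▸ (hw i).trans h
        obtain ⟨y, hyS, hy⟩ := (hS i (k i) hk1 (hkn i)).2 ((r (k i))⁻¹ • x i) (by
          rw [norm_smul, norm_inv, Real.norm_of_nonneg (hr _).le, ← div_eq_inv_mul,
            div_le_one (hr _)]
          have h1 : a i ≤ 32 * ((k i : ℝ) + 1) / n := by
            rw [le_div_iff₀ hn0, hki]
            have := Nat.lt_floor_add_one (n * a i / 32)
            change n * a i / 32 < (fl i : ℝ) + 1 at this
            linarith
          calc ‖x i‖ = a i ^ (1 / p.toReal) := by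
                rw [ha, ← Real.rpow_mul (norm_nonneg _), mul_one_div_cancel hp0.ne',
                  Real.rpow_one]
            _ ≤ _ := Real.rpow_le_rpow (ha0 i) h1 (by positivity))
        refine ⟨r (k i) • y, ?_, ?_⟩
        · simp only [net, if_neg (show k i ≠ 0 by omega)]
          exact Finset.mem_image_of_mem _ hyS
        · have h2 : Ti i (x i) - r (k i) • y
              = r (k i) • (Ti i ((r (k i))⁻¹ • x i) - y) := by
            rw [map_smul, smul_sub, smul_inv_smul₀ (hr _).ne']
          rw [h2, norm_smul, Real.norm_of_nonneg (hr _).le]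
          refine (mul_le_mul_of_nonneg_left hy (hr _).le).trans ?_
          refine radius_mul_le hp hθ0 hM.le hn0 (by exact_mod_cast hk1) ?_
          rw [hki]
          exact hfl i
      · have hki : k i = 0 := if_neg h
        refine ⟨0, by simp [net, hki], ?_⟩
        rw [sub_zero]
        have hw0 : (0 : ℝ) < w i := by exact_mod_cast hw i
        refine norm_apply_le_of_small (Ti i) (x i) hp hθ0 hpq hM.le hn0 hw0 (hnorm i) ?_
        have h1 : n * a i / 32 < w i := (Nat.floor_lt' (by have := hw i; omega)).1 (not_le.1 h)
        change n * a i ≤ 32 * w i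
        linarith
    choose y hynet hy using hy
    refine ⟨WithLp.toLp q y, Finset.mem_biUnion.2 ⟨k, hkmem,
      Finset.mem_image_of_mem _ (Fintype.mem_piFinset.2 hynet)⟩, ?_⟩
    refine PiLp.norm_le_of_forall_le_rpow q _ a ha0 hx _ (by positivity) fun i => ?_
    rw [PiLp.sub_apply, hT]
    exact hy i

/-- The weight of the `i`-th coordinate: about `log₂ (2 * (i + 1) / n)`, but at least one. -/
def coordWeight (n i : ℕ) : ℕ := max 1 (Nat.log 2 (2 * (i + 1) / n))

lemma inv_two_pow_coordWeight_le (n i : ℕ) (hn : 1 ≤ n) :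
    ((2 : ℝ) ^ coordWeight n i)⁻¹ ≤ n / (i + 1) := by
  have h1 : 2 * (i + 1) / n < 2 ^ (coordWeight n i + 1) :=
    (Nat.lt_pow_succ_log_self one_lt_two _).trans_le
      (Nat.pow_le_pow_right two_pos (Nat.succ_le_succ (le_max_right _ _)))
  have h2 : 2 * (i + 1) < 2 ^ (coordWeight n i + 1) * n := (Nat.div_lt_iff_lt_mul (by omega)).1 h1
  have h3 : i + 1 ≤ n * 2 ^ coordWeight n i := by
    rw [pow_succ] at h2
    linarith
  have h4 : (i : ℝ) + 1 ≤ n * 2 ^ coordWeight n i := by exact_mod_cast h3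
  rw [inv_le_iff_one_le_mul₀ (by positivity), div_mul_eq_mul_div, le_div_iff₀ (by positivity)]
  linarith

lemma sum_inv_four_pow_coordWeight_le (n m : ℕ) (hn : 1 ≤ n) (hnm : n ≤ m) :
    ∑ i ∈ Finset.range m, (((2 : ℝ) ^ coordWeight n i)⁻¹) ^ 2 ≤ 2 * n - n ^ 2 / m := by
  have hn0 : (0 : ℝ) < n := by exact_mod_cast hn
  induction m, hnm using Nat.le_induction with
  | base =>
    calc _ ≤ ∑ i ∈ Finset.range n, (1 : ℝ) := by
          refine Finset.sum_le_sum fun i _ => pow_le_one₀ (by positivity) ?_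
          exact inv_le_one_of_one_le₀ (one_le_pow₀ one_le_two)
      _ = 2 * n - n ^ 2 / n := by
          simp
          field_simp
          ring
  | succ m hm ih =>
    rw [Finset.sum_range_succ]
    have hm0 : (0 : ℝ) < m := by exact_mod_cast hn.trans hm
    have h1 : (((2 : ℝ) ^ coordWeight n m)⁻¹) ^ 2 ≤ (n / (m + 1)) ^ 2 :=
      pow_le_pow_left₀ (by positivity) (inv_two_pow_coordWeight_le n m hn) 2
    have h2 : ((n : ℝ) / (m + 1)) ^ 2 ≤ n ^ 2 / m - n ^ 2 / (m + 1) := by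
      rw [div_sub_div _ _ hm0.ne' (by positivity), div_pow,
        div_le_div_iff₀ (by positivity) (by positivity)]
      nlinarith [mul_pos (pow_pos hn0 2) (show (0 : ℝ) < m + 1 by positivity)]
    push_cast
    linarith

lemma sum_Icc_inv_pow_le (w n : ℕ) (hw : 1 ≤ w) :
    ∑ j ∈ Finset.Icc w n, ((1 : ℝ) / 128) ^ j ≤ (1 / 16) * (((2 : ℝ) ^ w)⁻¹) ^ 2 := by
  have h1 : ∑ j ∈ Finset.Icc w n, ((1 : ℝ) / 128) ^ j ≤ 2 * (1 / 128) ^ w := by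
    rcases Nat.lt_or_ge n w with h | h
    · rw [Finset.Icc_eq_empty (by omega)]
      simp
    · suffices ∑ j ∈ Finset.Icc w n, ((1 : ℝ) / 128) ^ j ≤ 2 * (1 / 128) ^ w - (1 / 128) ^ n by
        have h2 : (0 : ℝ) < (1 / 128) ^ n := by positivity
        linarith
      induction n, h using Nat.le_induction with
      | base =>
        rw [Finset.Icc_self, Finset.sum_singleton]
        linarith
      | succ n hn ih =>
        rw [Finset.sum_Icc_succ_top (by omega), pow_succ]
        have h2 : (0 : ℝ) < (1 / 128) ^ n := by positivity
        linarith
  have h2 : ((1 : ℝ) / 128) ^ w = (1 / 32) ^ w * (((2 : ℝ) ^ w)⁻¹) ^ 2 := by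
    rw [← inv_pow, ← pow_mul, mul_comm w 2, pow_mul, ← mul_pow]
    norm_num
  have h3 : ((1 : ℝ) / 32) ^ w ≤ 1 / 32 := by
    simpa using pow_le_pow_of_le_one (a := (1 / 32 : ℝ)) (by norm_num) (by norm_num) hw
  calc _ ≤ 2 * ((1 : ℝ) / 128) ^ w := h1
    _ = 2 * (1 / 32) ^ w * (((2 : ℝ) ^ w)⁻¹) ^ 2 := by rw [h2]; ring
    _ ≤ 2 * (1 / 32) * (((2 : ℝ) ^ w)⁻¹) ^ 2 := by gcongr
    _ = _ := by ring

/-- The number of centres needed in the covering argument is at most `2 ^ (n - 1)`. -/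
lemma sum_bitAllocations_le (m n : ℕ) (hn : 1 ≤ n) (hnm : n ≤ m) :
    ∑ k ∈ bitAllocations n (fun i : Fin m => coordWeight n i), 2 ^ ∑ i, k i ≤ 2 ^ (n - 1) := by
  set w : Fin m → ℕ := fun i => coordWeight n i with hw
  have hw1 : ∀ i, 1 ≤ w i := fun i => le_max_left _ _
  set N := ∑ k ∈ bitAllocations n w, 2 ^ ∑ i, k i with hN
  have hterm : ∀ k ∈ bitAllocations n w,
      (2 : ℝ) ^ ∑ i, k i ≤ 2 ^ ((n : ℝ) / 4) * ∏ i, (1 / 128) ^ k i := by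
    intro k hk
    have hs : 32 * ∑ i, k i ≤ n := (Finset.mem_filter.1 hk).2
    rw [Finset.prod_pow_eq_pow_sum]
    set s := ∑ i, k i
    have hsR : (8 * s : ℕ) ≤ (n : ℝ) / 4 := by
      have : (32 : ℝ) * s ≤ n := by exact_mod_cast hs
      push_cast
      linarith
    rw [one_div, inv_pow, ← div_eq_mul_inv, le_div_iff₀ (by positivity), ← mul_pow]
    calc ((2 : ℝ) * 128) ^ s = 2 ^ ((8 * s : ℕ) : ℝ) := by
          rw [Real.rpow_natCast, pow_mul]
          norm_num
      _ ≤ _ := Real.rpow_le_rpow_of_exponent_le one_le_two hsR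
  have hprod : ∏ i, ∑ j ∈ insert 0 (Finset.Icc (w i) n), ((1 : ℝ) / 128) ^ j
      ≤ 2 ^ ((n : ℝ) / 4) := by
    calc ∏ i, ∑ j ∈ insert 0 (Finset.Icc (w i) n), ((1 : ℝ) / 128) ^ j
        ≤ ∏ i, Real.exp ((1 / 16) * (((2 : ℝ) ^ w i)⁻¹) ^ 2) := by
          refine Finset.prod_le_prod (fun i _ => by positivity) fun i _ => ?_
          rw [Finset.sum_insert (by have := hw1 i; simp; omega)]
          refine le_trans ?_ (Real.add_one_le_exp _)
          have := sum_Icc_inv_pow_le (w i) n (hw1 i)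
          rw [pow_zero]
          linarith
      _ = Real.exp ((1 / 16) * ∑ i, (((2 : ℝ) ^ w i)⁻¹) ^ 2) := by
          rw [← Real.exp_sum, Finset.mul_sum]
      _ ≤ Real.exp (Real.log 2 * (n / 4)) := by
          apply Real.exp_le_exp.2
          have h1 := sum_inv_four_pow_coordWeight_le n m hn hnm
          rw [← Fin.sum_univ_eq_sum_range (fun i => (((2 : ℝ) ^ coordWeight n i)⁻¹) ^ 2) m] at h1
          have h2 : (0 : ℝ) ≤ n ^ 2 / m := by positivity
          have h3 := Real.log_two_gt_d9
          have h4 : (0 : ℝ) ≤ n := by positivity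
          nlinarith
      _ = 2 ^ ((n : ℝ) / 4) := (Real.rpow_def_of_pos two_pos _).symm
  have hNR : (N : ℝ) ≤ 2 ^ ((n : ℝ) / 2) := by
    calc (N : ℝ) = ∑ k ∈ bitAllocations n w, (2 : ℝ) ^ ∑ i, k i := by rw [hN]; push_cast; rfl
      _ ≤ ∑ k ∈ bitAllocations n w, 2 ^ ((n : ℝ) / 4) * ∏ i, ((1 : ℝ) / 128) ^ k i :=
          Finset.sum_le_sum hterm
      _ ≤ ∑ k ∈ Fintype.piFinset fun i => insert 0 (Finset.Icc (w i) n),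
            2 ^ ((n : ℝ) / 4) * ∏ i, ((1 : ℝ) / 128) ^ k i :=
          Finset.sum_le_sum_of_subset_of_nonneg (Finset.filter_subset _ _)
            fun k _ _ => by positivity
      _ = 2 ^ ((n : ℝ) / 4) * ∏ i, ∑ j ∈ insert 0 (Finset.Icc (w i) n), ((1 : ℝ) / 128) ^ j := by
          rw [← Finset.mul_sum, Finset.prod_univ_sum]
      _ ≤ 2 ^ ((n : ℝ) / 4) * 2 ^ ((n : ℝ) / 4) := by gcongr
      _ = 2 ^ ((n : ℝ) / 2) := by
          rw [← Real.rpow_add two_pos]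
          congr 1
          ring
  have hsq : N ^ 2 ≤ 2 ^ n := by
    have : (N : ℝ) ^ 2 ≤ 2 ^ n := by
      calc (N : ℝ) ^ 2 ≤ (2 ^ ((n : ℝ) / 2)) ^ 2 := by gcongr
        _ = 2 ^ n := by
          rw [← Real.rpow_natCast, ← Real.rpow_mul two_pos.le, ← Real.rpow_natCast]
          congr 1
          push_cast
          ring
    exact_mod_cast this
  by_contra! hlt
  rcases hn.eq_or_lt with rfl | hn2
  · simp at hlt hsq
    nlinarith
  · have h1 : (2 ^ (n - 1)) ^ 2 < N ^ 2 := Nat.pow_lt_pow_left hlt two_ne_zero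
    rw [← pow_mul] at h1
    have h2 : 2 ^ n ≤ 2 ^ ((n - 1) * 2) := Nat.pow_le_pow_right two_pos (by omega)
    omega

lemma coordWeight_le_logb (n i : ℕ) (hn : 1 ≤ n) (hi : n ≤ i + 1) :
    (coordWeight n i : ℝ) ≤ Real.logb 2 (2 * ((i : ℝ) + 1) / n) := by
  have hn0 : (0 : ℝ) < n := by exact_mod_cast hn
  have hd : 2 ≤ 2 * (i + 1) / n := (Nat.le_div_iff_mul_le (by omega)).2 (by omega)
  have hlog : 1 ≤ Nat.log 2 (2 * (i + 1) / n) := Nat.log_pos one_lt_two hd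
  rw [coordWeight, max_eq_right hlog, Real.le_logb_iff_rpow_le one_lt_two (by positivity),
    Real.rpow_natCast]
  calc (2 : ℝ) ^ Nat.log 2 (2 * (i + 1) / n) ≤ (2 * (i + 1) / n : ℕ) := by
        exact_mod_cast Nat.pow_log_le_self 2 (by omega)
    _ ≤ ((2 * (i + 1) : ℕ) : ℝ) / n := Nat.cast_div_le
    _ = _ := by push_cast; ring

lemma one_le_coordWeight (n i : ℕ) : 1 ≤ coordWeight n i := le_max_left _ _

lemma coordWeight_eq_one (n i : ℕ) (hi : i + 1 ≤ n) : coordWeight n i = 1 := by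
  refine max_eq_left ?_
  have h : 2 * (i + 1) / n ≤ 2 := Nat.div_le_of_le_mul (by omega)
  exact (Nat.log_mono_right h).trans (Nat.log_eq_one_iff.2 (by omega)).le

/-- Theorem 3.3(i): two-sided estimates for the entropy numbers of the diagonal operator
`T = (T₁, …, T_m) : ℓ_p^m({Xᵢ}) → ℓ_q^m({Yᵢ})` when `m ≥ 2n`, `m ≤ 2ⁿ`, the norms `‖Tᵢ‖`
are non-increasing and `‖T₁‖ ≤ 2‖T_n‖`.  Operators are indexed by `Fin m`, so the paper's
`T_s` (for `s ∈ {1,…,m}`) is `Ti ⟨s-1, _⟩` here. -/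
theorem entropy_diagonal_general (p q : ℝ≥0∞) [Fact (1 ≤ p)] [Fact (1 ≤ q)] (hpq : p < q) :
    ∃ c₁ c₂ : ℝ, 0 < c₁ ∧ 0 < c₂ ∧
      ∀ (m n : ℕ) (hn : 1 ≤ n) (hmn : 2 * n ≤ m) (hm2 : m ≤ 2 ^ n)
        (X Y : Fin m → Type)
        [∀ i, NormedAddCommGroup (X i)] [∀ i, NormedSpace ℝ (X i)]
        [∀ i, NormedAddCommGroup (Y i)] [∀ i, NormedSpace ℝ (Y i)]
        (Ti : ∀ i, X i →L[ℝ] Y i)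
        (hmono : ∀ i j : Fin m, i ≤ j → ‖Ti j‖ ≤ ‖Ti i‖)
        (hT1n : ‖Ti ⟨0, by omega⟩‖ ≤ 2 * ‖Ti ⟨n - 1, by omega⟩‖)
        (T : PiLp p X →L[ℝ] PiLp q Y),
        (∀ x i, T x i = Ti i (x i)) →
        let A : ℝ := (Finset.univ.filter
            (fun s : Fin m => n ≤ s.val + 1 ∧ s.val + 1 ≤ 2 ^ n)).sup'
          ⟨⟨n - 1, by omega⟩, by
            simp only [Finset.mem_filter, Finset.mem_univ, true_and]
            exact ⟨by omega, le_trans (by omega) hm2⟩⟩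
          (fun s => ‖Ti s‖ *
            (Real.logb 2 (2 * ((s.val : ℝ) + 1) / n) / n) ^ (1 / p.toReal - 1 / q.toReal))
        let B : ℝ := ((Finset.Icc 1 n) ×ˢ (Finset.univ : Finset (Fin m))).sup'
          ⟨(1, ⟨0, by omega⟩), by
            simp only [Finset.mem_product, Finset.mem_Icc, Finset.mem_univ, and_true]
            omega⟩
          (fun ki => ((ki.1 : ℝ) / n) ^ (1 / p.toReal - 1 / q.toReal)
            * entropyNum ki.1 (Ti ki.2))
        c₁ * A ≤ entropyNum n T ∧ entropyNum n T ≤ c₂ * max A B := by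
  have hp1 : 1 ≤ p.toReal := by
    simpa using ENNReal.toReal_mono hpq.ne_top (Fact.out : 1 ≤ p)
  have hp0 : 0 < p.toReal := by linarith
  have hθp : 1 / q.toReal ≤ 1 / p.toReal := by
    rcases eq_or_ne q ∞ with rfl | hq
    · simp
    · exact one_div_le_one_div_of_le hp0 (ENNReal.toReal_mono hq hpq.le)
  have hα0 : 0 ≤ 1 / p.toReal - 1 / q.toReal := by linarith
  have hα1 : 1 / p.toReal - 1 / q.toReal ≤ 1 := by
    have h1 : 1 / p.toReal ≤ 1 := by rw [div_le_one hp0]; exact hp1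
    have h2 : 0 ≤ 1 / q.toReal := by positivity
    linarith
  refine ⟨1 / 2048, 64, by norm_num, by norm_num, ?_⟩
  intro m n hn hmn hm2 X Y _ _ _ _ Ti hmono hT1n T hT A B
  have hn0 : (0 : ℝ) < n := by exact_mod_cast hn
  have hl : ∀ s : Fin m, n ≤ s.val + 1 → 1 ≤ Real.logb 2 (2 * ((s.val : ℝ) + 1) / n) := by
    intro s hs
    refine le_trans ?_ (coordWeight_le_logb n s hn hs)
    exact_mod_cast one_le_coordWeight n s
  constructor
  · rw [← le_div_iff₀' (by norm_num)]
    refine Finset.sup'_le _ _ fun s hs => ?_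
    obtain ⟨hs1, hs2⟩ := (Finset.mem_filter.1 hs).2
    rw [le_div_iff₀' (by norm_num)]
    obtain ⟨k, b, hk, hkb, hkl, hcode⟩ := exists_block_parameters n (s.val + 1) hn hs1 hs2
    have hs' := s.isLt
    let φ : Fin k × Fin b → Fin m := fun a => Fin.castLE (by omega) (finProdFinEquiv a)
    have hφ : Function.Injective φ :=
      (Fin.castLE_injective _).comp finProdFinEquiv.injective
    have hlow := packing_le_entropyNum hp0 Ti T hT n k b hn hk hcode φ hφ ‖Ti s‖ (norm_nonneg _)
      fun a => hmono _ _ (by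
        have : (finProdFinEquiv a).val < k * b := (finProdFinEquiv a).isLt
        rw [Fin.le_def, Fin.val_castLE]
        omega)
    have hcmp := rpow_le_four_mul_rpow_neg (k := k) (by exact_mod_cast hk)
      (zero_lt_one.trans_le (hl s hs1)) hn0 hα0 hα1 (by push_cast at hkl; exact hkl)
    refine le_trans ?_ hlow
    calc _ ≤ 1 / 2048 * (‖Ti s‖ * (4 * (k : ℝ) ^ (-(1 / p.toReal - 1 / q.toReal)))) := by gcongr
      _ = _ := by ring
  · rw [← div_le_iff₀' (by norm_num)]
    refine le_of_forall_gt_imp_ge_of_dense fun M hM => ?_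
    rw [div_le_iff₀' (by norm_num)]
    have hAM : A < M := (le_max_left _ _).trans_lt hM
    have hBM : B < M := (le_max_right _ _).trans_lt hM
    have hA : ∀ s : Fin m, n ≤ s.val + 1 → ‖Ti s‖ *
        (Real.logb 2 (2 * ((s.val : ℝ) + 1) / n) / n) ^ (1 / p.toReal - 1 / q.toReal) ≤ A := by
      intro s hs
      exact Finset.le_sup' (f := fun s : Fin m => ‖Ti s‖ *
        (Real.logb 2 (2 * ((s.val : ℝ) + 1) / n) / n) ^ (1 / p.toReal - 1 / q.toReal))
        (Finset.mem_filter.2 ⟨Finset.mem_univ _, hs, le_trans (by omega) hm2⟩)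
    have hM0 : 0 < M := by
      refine lt_of_le_of_lt ?_ hAM
      refine le_trans ?_ (hA ⟨n - 1, by omega⟩ (by simp; omega))
      have := hl ⟨n - 1, by omega⟩ (by simp; omega)
      positivity
    have hlarge : ∀ s : Fin m, n ≤ s.val + 1 → ‖Ti s‖ ≤
        M * ((n : ℝ) / coordWeight n s) ^ (1 / p.toReal - 1 / q.toReal) := by
      intro s hs
      have hw0 : (0 : ℝ) < coordWeight n s := by exact_mod_cast one_le_coordWeight n s
      rw [← inv_div, Real.inv_rpow (by positivity), ← div_eq_mul_inv,
        le_div_iff₀ (by positivity)]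
      refine le_trans ?_ ((hA s hs).trans hAM.le)
      gcongr
      exact coordWeight_le_logb n s hn hs
    refine entropyNum_le_of_bitAllocations hp1 hθp Ti T hT n hn (fun i => coordWeight n i)
      (fun i => one_le_coordWeight n i) M hM0 (fun i => ?_) (fun i k hk1 hkn => ?_)
      (sum_bitAllocations_le m n hn (by omega))
    · rcases le_total n (i.val + 1) with hi | hi
      · refine (hlarge i hi).trans ?_
        gcongr
        linarith
      · have h1 := hlarge ⟨n - 1, by omega⟩ (by simp; omega)
        rw [coordWeight_eq_one n _ (by simp; omega)] at h1
        rw [coordWeight_eq_one n i hi]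
        have h2 := hmono ⟨0, by omega⟩ i (Nat.zero_le _)
        linarith
    · have hk0 : (0 : ℝ) < k := by exact_mod_cast hk1
      rw [← inv_div, Real.inv_rpow (by positivity), ← div_eq_mul_inv,
        lt_div_iff₀ (by positivity), mul_comm]
      refine lt_of_le_of_lt ?_ hBM
      exact Finset.le_sup' (f := fun ki : ℕ × Fin m =>
        ((ki.1 : ℝ) / n) ^ (1 / p.toReal - 1 / q.toReal) * entropyNum ki.1 (Ti ki.2))
        (b := (k, i)) (by simp; omega)
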